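/- Let Δ be a root system of a simple Lie algebra with a fixed set of positive roots Δ⁺, and let 𝔞 be an abelian ideal of the Borel subalgebra with root set Δ_𝔞 ⊂ Δ⁺. If γ₁, γ₂ ∈ Δ_𝔞 are strongly orthogonal (neither γ₁+γ₂ nor γ₁−γ₂ is a root) and δ ∈ Δ⁺ satisfies γ₁+δ ∈ Δ⁺, then γ₂+δ ∉ Δ⁺. -/

import Mathlib

open RealInnerProductSpace

/-- Minimal data of a crystallographic reduced root system in a real inner product space. -/
structure RootSystemData (V : Type*) [NormedAddCommGroup V] [InnerProductSpace ℝ V] where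
  Δ : Set V
  finite : Δ.Finite
  nonzero : ∀ α ∈ Δ, α ≠ (0 : V)
  neg_mem : ∀ α ∈ Δ, -α ∈ Δ
  reduced : ∀ α ∈ Δ, ∀ t : ℝ, t • α ∈ Δ → t = 1 ∨ t = -1
  crystallographic : ∀ α ∈ Δ, ∀ β ∈ Δ, ∃ n : ℤ, 2 * ⟪β, α⟫ = (n : ℝ) * ⟪α, α⟫
  reflect_mem : ∀ α ∈ Δ, ∀ β ∈ Δ, β - (2 * ⟪β, α⟫ / ⟪α, α⟫) • α ∈ Δ

variable {V : Type*} [NormedAddCommGroup V] [InnerProductSpace ℝ V]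

/-- `P` is a positive system for the root system `R`. -/
def IsPositiveSystem (R : RootSystemData V) (P : Set V) : Prop :=
  P ⊆ R.Δ ∧ (∀ α ∈ R.Δ, α ∈ P ∨ -α ∈ P) ∧ (∀ α ∈ P, -α ∉ P) ∧
    ∀ α ∈ P, ∀ β ∈ P, α + β ∈ R.Δ → α + β ∈ P

/-- `Δa` is a combinatorial abelian ideal in the positive system `P`. -/
def IsCombinatorialAbelianIdeal (R : RootSystemData V) (P Δa : Set V) : Prop :=
  Δa ⊆ P ∧ (∀ γ ∈ Δa, ∀ μ ∈ P, γ + μ ∈ P → γ + μ ∈ Δa) ∧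
    ∀ γ₁ ∈ Δa, ∀ γ₂ ∈ Δa, γ₁ + γ₂ ∉ R.Δ

/-- Two roots are strongly orthogonal if neither their sum nor their difference is a root. -/
def StronglyOrthogonal (R : RootSystemData V) (γ₁ γ₂ : V) : Prop :=
  γ₁ ≠ γ₂ ∧ γ₁ + γ₂ ∉ R.Δ ∧ γ₁ - γ₂ ∉ R.Δ

/-- If two distinct roots have positive inner product, their difference is a root. -/
theorem RootSystemData.sub_mem_of_inner_pos (R : RootSystemData V) {α β : V}
    (hα : α ∈ R.Δ) (hβ : β ∈ R.Δ) (hne : α ≠ β) (hpos : 0 < ⟪α, β⟫) : α - β ∈ R.Δ := by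
  have hα0 : 0 < ⟪α, α⟫ := real_inner_self_pos.2 (R.nonzero α hα)
  have hβ0 : 0 < ⟪β, β⟫ := real_inner_self_pos.2 (R.nonzero β hβ)
  have hcomm : ⟪β, α⟫ = ⟪α, β⟫ := real_inner_comm α β
  obtain ⟨n, hn⟩ := R.crystallographic α hα β hβ
  obtain ⟨m, hm⟩ := R.crystallographic β hβ α hα
  have hn0 : 0 < n := by
    have : (0 : ℝ) < n := pos_of_mul_pos_left (by rw [← hn, hcomm]; linarith) hα0.le
    exact_mod_cast this
  have hm0 : 0 < m := by
    have : (0 : ℝ) < m := pos_of_mul_pos_left (by rw [← hm]; linarith) hβ0.le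
    exact_mod_cast this
  by_cases hn1 : n = 1
  · have h := R.neg_mem _ (R.reflect_mem α hα β hβ)
    rwa [hn, hn1, Int.cast_one, one_mul, div_self hα0.ne', one_smul, neg_sub] at h
  by_cases hm1 : m = 1
  · have h := R.reflect_mem β hβ α hα
    rwa [hm, hm1, Int.cast_one, one_mul, div_self hβ0.ne', one_smul] at h
  have hn2 : (2 : ℝ) ≤ n := by exact_mod_cast (by lia : (2 : ℤ) ≤ n)
  have hm2 : (2 : ℝ) ≤ m := by exact_mod_cast (by lia : (2 : ℤ) ≤ m)
  have hdiff : 0 < ⟪α - β, α - β⟫ := real_inner_self_pos.2 (sub_ne_zero.2 hne)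
  rw [real_inner_sub_sub_self] at hdiff
  nlinarith

/-- If the inner product of two roots is negative and they are not opposite,
their sum is a root. -/
theorem RootSystemData.add_mem_of_inner_neg (R : RootSystemData V) {α β : V}
    (hα : α ∈ R.Δ) (hβ : β ∈ R.Δ) (hne : α ≠ -β) (hneg : ⟪α, β⟫ < 0) : α + β ∈ R.Δ := by
  have h := R.sub_mem_of_inner_pos hα (R.neg_mem β hβ) hne
    (by rw [inner_neg_right]; linarith)
  rwa [sub_neg_eq_add] at h

/-- Two roots of an abelian ideal have nonnegative inner product. -/
theorem IsCombinatorialAbelianIdeal.inner_nonneg {R : RootSystemData V} {P Δa : Set V}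
    (hP : IsPositiveSystem R P) (hI : IsCombinatorialAbelianIdeal R P Δa)
    {α β : V} (hα : α ∈ Δa) (hβ : β ∈ Δa) : 0 ≤ ⟪α, β⟫ := by
  by_contra! hneg
  refine hI.2.2 α hα β hβ
    (R.add_mem_of_inner_neg (hP.1 (hI.1 hα)) (hP.1 (hI.1 hβ)) ?_ hneg)
  rintro rfl
  exact hP.2.2.1 β (hI.1 hβ) (hI.1 hα)

/-- Lemma 2.2(i): if `γ₁, γ₂` are strongly orthogonal roots of an abelian ideal and
`γ₁ + δ` is a positive root, then `γ₂ + δ` is not a positive root.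
(The type `G₂` is excluded, encoded by the absence of squared-length ratio `3`.) -/
theorem stmt0 (R : RootSystemData V) (P Δa : Set V)
    (hP : IsPositiveSystem R P) (hI : IsCombinatorialAbelianIdeal R P Δa)
    (hG2 : ¬ ∃ α ∈ R.Δ, ∃ β ∈ R.Δ, ⟪β, β⟫ = 3 * ⟪α, α⟫)
    {γ₁ γ₂ : V} (h1 : γ₁ ∈ Δa) (h2 : γ₂ ∈ Δa)
    (hso : StronglyOrthogonal R γ₁ γ₂)
    {δ : V} (hδ : δ ∈ P) (hsum : γ₁ + δ ∈ P) :
    γ₂ + δ ∉ P := by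
  intro hsum₂
  obtain ⟨hne, -, hsub⟩ := hso
  have hm₁ : γ₁ + δ ∈ Δa := hI.2.1 γ₁ h1 δ hδ hsum
  have hm₂ : γ₂ + δ ∈ Δa := hI.2.1 γ₂ h2 δ hδ hsum₂
  have hle : ⟪γ₁, γ₂⟫ ≤ 0 := by
    by_contra! hpos
    exact hsub (R.sub_mem_of_inner_pos (hP.1 (hI.1 h1)) (hP.1 (hI.1 h2)) hne hpos)
  have h₁ := hI.inner_nonneg hP h1 hm₂
  have h₂ := hI.inner_nonneg hP hm₁ h2
  have hδ0 : 0 < ⟪δ, δ⟫ := real_inner_self_pos.2 (R.nonzero δ (hP.1 hδ))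
  have hpos : 0 < ⟪γ₁ + δ, γ₂ + δ⟫ := by
    simp only [inner_add_left, inner_add_right] at h₁ h₂ ⊢
    linarith
  have h := R.sub_mem_of_inner_pos (hP.1 hsum) (hP.1 hsum₂) (by simpa using hne) hpos
  rw [add_sub_add_right_eq_sub] at h
  exact hsub h
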